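/- arXiv:2202.12661 — 2 statements merged into one kernel-verified Lean document; each statement's English description precedes it below -/
import Mathlib

section
/- Let G be a triangle-free simple graph with edge ideal I(G) in S = K[x1,…,xn]. Then depth_S I(G)^2 ≥ α₂(G), where α₂(G) is the star packing number of G. -/
open MvPolynomial
/-- The closed neighborhood of a vertex. -/
def closedNbhd {V : Type} (G : SimpleGraph V) (x : V) : Set V :=
  insert x (G.neighborSet x)

/-- A finite set of vertices is a star packing if the closed neighborhoods of its
elements (the vertex sets of the corresponding stars) are pairwise disjoint. -/
def IsStarPacking {V : Type} (G : SimpleGraph V) (s : Finset V) : Prop :=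
  (s : Set V).Pairwise fun x y => Disjoint (closedNbhd G x) (closedNbhd G y)

/-- The star packing number `α₂(G)`: the maximum size of a star packing. -/
noncomputable def starPackingNumber {V : Type} (G : SimpleGraph V) : ℕ :=
  sSup {n | ∃ s : Finset V, IsStarPacking G s ∧ s.card = n}

/-- The whiskered triangle `W(K₃)`: a triangle on vertices `0, 1, 2` with pendant
vertices `3, 4, 5` attached to them respectively. -/
def whiskeredTriangle : SimpleGraph (Fin 6) :=
  SimpleGraph.fromEdgeSet {s(0, 1), s(0, 2), s(1, 2), s(0, 3), s(1, 4), s(2, 5)}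

/-- `G` is `W(K₃)`-free: no induced subgraph of `G` is isomorphic to the whiskered
triangle. -/
def WK3Free {V : Type} (G : SimpleGraph V) : Prop :=
  ¬ ∃ f : Fin 6 ↪ V, ∀ a b, whiskeredTriangle.Adj a b ↔ G.Adj (f a) (f b)

/-- The edge ideal of a graph `G`, in the polynomial ring `K[x_v : v ∈ V]`. -/
noncomputable def edgeIdeal {V : Type} (K : Type) [Field K] (G : SimpleGraph V) :
    Ideal (MvPolynomial V K) :=
  Ideal.span {m | ∃ x y, G.Adj x y ∧ m = X x * X y}

/-- The depth of `S ⧸ J` with respect to the irrelevant maximal ideal `(x_v : v ∈ V)`: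
the supremum of lengths of regular sequences on `S ⧸ J` consisting of elements of the
irrelevant maximal ideal.  The depth of the ideal `J` itself (as a module) is, by the
usual convention for proper ideals, `quotDepth K J + 1`. -/
noncomputable def quotDepth {V : Type} (K : Type) [Field K]
    (J : Ideal (MvPolynomial V K)) : ℕ :=
  sSup {n | ∃ rs : List (MvPolynomial V K), rs.length = n ∧
    (∀ r ∈ rs, r ∈ Ideal.span (Set.range (X (R := K) (σ := V)))) ∧
    RingTheory.Sequence.IsRegular (MvPolynomial V K ⧸ J) rs}

/-- Weakly regular sequences on a cyclic module `R ⧸ J`, in terms of ideals. -/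
def WR {R : Type} [CommRing R] : Ideal R → List R → Prop
  | _, [] => True
  | J, r :: rs => (∀ x, r * x ∈ J → x ∈ J) ∧ WR (J ⊔ Ideal.span {r}) rs

theorem wr_split {R : Type} [CommRing R] (m : R) (rs : List R) :
    ∀ (J J1 J2 : Ideal R), (∀ z, z ∈ J1 ↔ m * z ∈ J) → J2 = J ⊔ Ideal.span {m} →
      WR J1 rs → WR J2 rs → WR J rs := by
  induction rs with
  | nil => intros; trivial
  | cons r rs ih =>
    intro J J1 J2 h1 h2 w1 w2
    have key : ∀ x, x ∈ J2 ↔ ∃ y ∈ J, ∃ z, y + m * z = x := by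
      intro x
      rw [h2, Submodule.mem_sup]
      constructor
      · rintro ⟨y, hy, z, hz, rfl⟩
        obtain ⟨c, rfl⟩ := Ideal.mem_span_singleton'.1 hz
        exact ⟨y, hy, c, by ring⟩
      · rintro ⟨y, hy, z, rfl⟩
        exact ⟨y, hy, m * z, Ideal.mem_span_singleton.2 (Dvd.intro _ rfl), rfl⟩
    refine ⟨?_, ?_⟩
    · intro x hx
      have hx2 : x ∈ J2 := w2.1 x (h2 ▸ Ideal.mem_sup_left hx)
      obtain ⟨y, hy, z, rfl⟩ := (key x).1 hx2
      have : r * z ∈ J1 := by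
        rw [h1]
        have h := J.sub_mem hx (J.mul_mem_left r hy)
        convert h using 1; ring
      exact J.add_mem hy ((h1 z).1 (w1.1 z this))
    · refine ih _ (J1 ⊔ Ideal.span {r}) (J2 ⊔ Ideal.span {r}) ?_ ?_ w1.2 w2.2
      · intro z
        constructor
        · intro hz
          obtain ⟨y, hy, w, hw, rfl⟩ := Submodule.mem_sup.1 hz
          rw [mul_add]
          exact Ideal.add_mem _ (Ideal.mem_sup_left ((h1 y).1 hy))
            (Ideal.mem_sup_right (Ideal.mul_mem_left _ _ hw))
        · intro hz
          obtain ⟨y, hy, w, hw, e⟩ := Submodule.mem_sup.1 hz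
          obtain ⟨c, rfl⟩ := Ideal.mem_span_singleton'.1 hw
          have hc : r * c ∈ J2 := (key _).2 ⟨-y, J.neg_mem hy, z, by rw [← e]; ring⟩
          obtain ⟨y', hy', w', e'⟩ := (key c).1 (w2.1 c hc)
          have : z - r * w' ∈ J1 := by
            rw [h1]
            have h := J.add_mem hy (J.mul_mem_left r hy')
            convert h using 1
            rw [mul_sub, ← e, ← e']; ring
          refine Submodule.mem_sup.2 ⟨_, this, r * w', ?_, by ring⟩
          exact Ideal.mem_span_singleton.2 (Dvd.intro _ rfl)
      · rw [h2, sup_right_comm]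

open Pointwise in
theorem wr_isWeaklyRegular {R : Type} [CommRing R] (rs : List R) :
    ∀ J : Ideal R, WR J rs → RingTheory.Sequence.IsWeaklyRegular (R ⧸ J) rs := by
  induction rs with
  | nil => intro J _; exact RingTheory.Sequence.IsWeaklyRegular.nil R _
  | cons r rs ih =>
    intro J h
    refine RingTheory.Sequence.IsWeaklyRegular.cons ?_ ?_
    · rw [isSMulRegular_iff_right_eq_zero_of_smul]
      intro x hx
      obtain ⟨x, rfl⟩ := Ideal.Quotient.mk_surjective x
      rw [Algebra.smul_def] at hx
      have : Ideal.Quotient.mk J (r * x) = 0 := by rw [map_mul]; exact hx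
      exact Ideal.Quotient.eq_zero_iff_mem.2 (h.1 x (Ideal.Quotient.eq_zero_iff_mem.1 this))
    · have e1 := Submodule.quotientQuotientEquivQuotientSup J (Ideal.span {r})
      have e2 : (r • (⊤ : Submodule R (R ⧸ J))) = Submodule.map J.mkQ (Ideal.span {r}) := by
        rw [← Submodule.ideal_span_singleton_smul]
        have : (⊤ : Submodule R (R ⧸ J)) = Submodule.map J.mkQ ⊤ := by
          rw [Submodule.map_top, Submodule.range_mkQ]
        rw [this, ← Submodule.map_smul'']
        simp
      exact (LinearEquiv.isWeaklyRegular_congr ((Submodule.quotEquivOfEq _ _ e2).trans e1) rs).2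
        (ih _ h.2)

theorem isRegular_length_le {R : Type} [CommRing R] [IsNoetherianRing R] (rs : List R) :
    ∀ (M : Type) [AddCommGroup M] [Module R M] [Module.Finite R M],
      RingTheory.Sequence.IsRegular M rs → (rs.length : WithBot ℕ∞) ≤ Module.supportDim R M := by
  induction rs with
  | nil =>
    intro M _ _ _ h
    have hn : Nontrivial M := by
      by_contra hn
      rw [not_nontrivial_iff_subsingleton] at hn
      exact h.top_ne_smul (Subsingleton.elim _ _)
    have := (Module.supportDim_ne_bot_iff_nontrivial R M).2 hn
    have h2 : Nonempty (Module.support R M) := Module.nonempty_support_of_nontrivial.to_subtype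
    simpa [Module.supportDim] using Order.krullDim_nonneg
  | cons r rs ih =>
    intro M _ _ _ h
    rw [RingTheory.Sequence.isRegular_cons_iff] at h
    have h1 := ih (QuotSMulTop r M) h.2
    have h2 := Module.supportDim_quotSMulTop_succ_le_of_notMem_minimalPrimes (R := R) (M := M)
      (x := r) (fun _ => h.1.notMem_of_mem_minimalPrimes)
    refine le_trans ?_ h2
    push_cast [List.length_cons]
    gcongr

/-- The monomial ideal spanned by the monomials with exponents in `U`. -/
noncomputable def MI {V : Type} (K : Type) [Field K] (U : Set (V →₀ ℕ)) :
    Ideal (MvPolynomial V K) :=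
  Ideal.span ((fun s => monomial s (1 : K)) '' U)

theorem mem_MI {V K : Type} [Field K] {U : Set (V →₀ ℕ)} (hU : IsUpperSet U)
    {x : MvPolynomial V K} : x ∈ MI K U ↔ ∀ a, coeff a x ≠ 0 → a ∈ U := by
  rw [MI, mem_ideal_span_monomial_image]
  constructor
  · intro h a ha
    obtain ⟨s, hs, hle⟩ := h a (mem_support_iff.2 ha)
    exact hU hle hs
  · intro h a ha
    exact ⟨a, h a (mem_support_iff.1 ha), le_rfl⟩

theorem reg_split {V K : Type} [Field K] {U : Set (V →₀ ℕ)} (hU : IsUpperSet U) (m : V →₀ ℕ)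
    (rs : List (MvPolynomial V K)) (h1 : WR (MI K {a | a + m ∈ U}) rs)
    (h2 : WR (MI K (U ∪ Set.Ici m)) rs) : WR (MI K U) rs := by
  refine wr_split (monomial m (1 : K)) rs _ _ _ ?_ ?_ h1 h2
  · intro z
    have hU' : IsUpperSet {a | a + m ∈ U} := by
      intro a b hab ha
      exact hU (add_le_add_left hab m) ha
    rw [mem_MI hU', mem_MI hU]
    constructor
    · intro h a ha
      rw [coeff_monomial_mul'] at ha
      split_ifs at ha with hm
      · have := h (a - m) (by simpa using ha)
        simpa [tsub_add_cancel_of_le hm] using this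
      · simp at ha
    · intro h a ha
      apply h
      rw [coeff_monomial_mul']
      simpa using ha
  · apply le_antisymm
    · rw [MI, Ideal.span_le]
      rintro _ ⟨a, ha | ha, rfl⟩
      · exact Ideal.mem_sup_left (Ideal.subset_span ⟨a, ha, rfl⟩)
      · apply Ideal.mem_sup_right
        rw [Ideal.mem_span_singleton]
        exact monomial_dvd_monomial.2 ⟨Or.inr ha, dvd_rfl⟩
    · rw [sup_le_iff]
      constructor
      · exact Ideal.span_mono (Set.image_mono Set.subset_union_left)
      · rw [Ideal.span_singleton_le_iff_mem]
        exact Ideal.subset_span ⟨m, Or.inr (Set.mem_Ici.2 le_rfl), rfl⟩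

/-- The linear form with given coefficients. -/
noncomputable def linF {V K : Type} [Fintype V] [Field K] : (V → K) →ₗ[K] MvPolynomial V K :=
  Fintype.linearCombination K (X : V → MvPolynomial V K)

theorem linF_single {V K : Type} [Fintype V] [DecidableEq V] [Field K] (v : V) :
    linF (Pi.single v (1 : K)) = X v := by
  simp [linF, Fintype.linearCombination_apply_single]

theorem linF_injective {V K : Type} [Fintype V] [Field K] :
    Function.Injective (linF : (V → K) →ₗ[K] MvPolynomial V K) := by
  classical
  rw [← LinearMap.ker_eq_bot, LinearMap.ker_eq_bot']
  intro c hc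
  ext v
  have := congrArg (coeff (Finsupp.single v 1)) hc
  simpa [linF, Fintype.linearCombination_apply, coeff_sum, coeff_X, Finsupp.single_left_inj]
    using this

theorem linF_mem {V K : Type} [Fintype V] [Field K] (c : V → K) :
    linF c ∈ Ideal.span (Set.range (X (R := K) (σ := V))) := by
  rw [linF, Fintype.linearCombination_apply]
  refine Ideal.sum_mem _ fun v _ => ?_
  rw [smul_eq_C_mul]
  exact Ideal.mul_mem_left _ _ (Ideal.subset_span ⟨v, rfl⟩)

/-- The ideal generated by a space of linear forms. -/
noncomputable def linI {V K : Type} [Fintype V] [Field K] (L : Submodule K (V → K)) :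
    Ideal (MvPolynomial V K) := Ideal.span (linF '' (L : Set (V → K)))

theorem linI_exists_hom {V K : Type} [Fintype V] [Field K] (L : Submodule K (V → K)) :
    ∃ φ : MvPolynomial V K →ₐ[K] MvPolynomial V K,
      (∀ x, x ∈ linI L ↔ φ x = 0) ∧ (∀ c, φ (linF c) = 0 → c ∈ L) := by
  classical
  obtain ⟨L', hL'⟩ := Submodule.exists_isCompl L
  let p : (V → K) →ₗ[K] (V → K) := L'.subtype ∘ₗ Submodule.projectionOnto L' L hL'.symm
  have hp1 : ∀ c, p c = 0 ↔ c ∈ L := by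
    intro c
    simp [p]
  have hp2 : ∀ c, c - p c ∈ L := by
    intro c
    rw [← hp1, map_sub, sub_eq_zero]
    simp only [p, LinearMap.comp_apply, Submodule.subtype_apply,
      Submodule.projectionOnto_apply_left]
  let φ : MvPolynomial V K →ₐ[K] MvPolynomial V K := aeval fun v => linF (p (Pi.single v 1))
  have hφ : ∀ c, φ (linF c) = linF (p c) := by
    intro c
    have : φ.toLinearMap ∘ₗ linF = linF ∘ₗ p := by
      refine LinearMap.pi_ext' fun v => LinearMap.ext_ring ?_
      simp [linF_single, φ]
    exact congrArg (fun f => f c) this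
  have h1 : ∀ x, x - φ x ∈ linI L := by
    intro x
    induction x using MvPolynomial.induction_on with
    | C a => simp [φ, algebraMap_eq]
    | add a b ha hb =>
      have := Ideal.add_mem _ ha hb
      rw [map_add]
      convert this using 1; ring
    | mul_X a v ha =>
      have hv : X v - φ (X v) ∈ linI L := by
        rw [← linF_single, hφ, ← map_sub]
        exact Ideal.subset_span ⟨_, hp2 _, rfl⟩
      have := Ideal.add_mem _ (Ideal.mul_mem_right (X v) _ ha) (Ideal.mul_mem_left _ (φ a) hv)
      rw [map_mul]
      convert this using 1; ring
  refine ⟨φ, ?_, ?_⟩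
  · intro x
    constructor
    · intro hx
      have : linI L ≤ RingHom.ker φ := by
        rw [linI, Ideal.span_le]
        rintro _ ⟨c, hc, rfl⟩
        simp only [SetLike.mem_coe, RingHom.mem_ker]
        rw [hφ, (hp1 c).2 hc, map_zero]
      exact this hx
    · intro hx
      have := h1 x
      rwa [hx, sub_zero] at this
  · intro c hc
    rw [hφ] at hc
    exact (hp1 c).1 (linF_injective (by simpa using hc))

theorem linI_sup {V K : Type} [Fintype V] [Field K] (L : Submodule K (V → K)) (c : V → K) :
    linI L ⊔ Ideal.span {linF c} = linI (L ⊔ Submodule.span K {c}) := by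
  apply le_antisymm
  · rw [sup_le_iff]
    constructor
    · exact Ideal.span_mono (Set.image_mono (SetLike.coe_subset_coe.2 le_sup_left))
    · rw [Ideal.span_singleton_le_iff_mem]
      exact Ideal.subset_span ⟨c, Submodule.mem_sup_right (Submodule.mem_span_singleton_self c), rfl⟩
  · rw [linI, Ideal.span_le]
    rintro _ ⟨d, hd, rfl⟩
    obtain ⟨y, hy, z, hz, rfl⟩ := Submodule.mem_sup.1 hd
    obtain ⟨k, rfl⟩ := Submodule.mem_span_singleton.1 hz
    rw [map_add, map_smul, smul_eq_C_mul]
    exact Ideal.add_mem _ (Ideal.mem_sup_left (Ideal.subset_span ⟨y, hy, rfl⟩))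
      (Ideal.mem_sup_right (Ideal.mul_mem_left _ _ (Ideal.mem_span_singleton_self _)))

/-- Linear forms, each avoiding the span of its predecessors, form a weakly regular sequence. -/
theorem wr_linI {V K ι : Type} [Fintype V] [Field K] (g : ι → V → K) (l : List ι) :
    ∀ (L : Submodule K (V → K)), l.Nodup →
      (∀ i ∈ l, ∃ θ : (V → K) →ₗ[K] K, (∀ c ∈ L, θ c = 0) ∧ (∀ j ∈ l, j ≠ i → θ (g j) = 0) ∧
        θ (g i) ≠ 0) → WR (linI L) (l.map fun i => linF (g i)) := by
  induction l with
  | nil => intros; trivial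
  | cons i l ih =>
    intro L hl h
    rw [List.nodup_cons] at hl
    refine ⟨?_, ?_⟩
    · obtain ⟨φ, h1, h2⟩ := linI_exists_hom L
      intro x hx
      rw [h1, map_mul, mul_eq_zero] at hx
      rcases hx with hx | hx
      · obtain ⟨θ, t1, -, t3⟩ := h i (by simp)
        exact absurd (t1 _ (h2 _ hx)) t3
      · exact (h1 x).2 hx
    · rw [linI_sup]
      refine ih _ hl.2 ?_
      intro j hj
      obtain ⟨θ, t1, t2, t3⟩ := h j (by simp [hj])
      refine ⟨θ, ?_, fun k hk => t2 k (by simp [hk]), t3⟩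
      intro c hc
      obtain ⟨y, hy, z, hz, rfl⟩ := Submodule.mem_sup.1 hc
      obtain ⟨k, rfl⟩ := Submodule.mem_span_singleton.1 hz
      rw [map_add, t1 y hy, map_smul, t2 i (by simp) (by rintro rfl; exact hl.1 hj)]
      simp

/-- Exponents of monomials divisible by a variable in `A`. -/
def varSet {V : Type} (A : Set V) : Set (V →₀ ℕ) := {a | ∃ v ∈ A, a v ≠ 0}

/-- Exponents of monomials in the ideal generated by the variables in `A` and the edges of `H`. -/
def St {V : Type} (H : SimpleGraph V) (A : Set V) : Set (V →₀ ℕ) :=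
  {a | (∃ v ∈ A, a v ≠ 0) ∨ ∃ x y, H.Adj x y ∧ a x ≠ 0 ∧ a y ≠ 0}

theorem ne_zero_of_le {V : Type} {a b : V →₀ ℕ} (h : a ≤ b) {v : V} (hv : a v ≠ 0) : b v ≠ 0 := by
  have := h v
  omega

theorem St_upper {V : Type} (H : SimpleGraph V) (A : Set V) : IsUpperSet (St H A) := by
  rintro a b hab (⟨v, hv, h⟩ | ⟨x, y, hxy, hx, hy⟩)
  · exact Or.inl ⟨v, hv, ne_zero_of_le hab h⟩
  · exact Or.inr ⟨x, y, hxy, ne_zero_of_le hab hx, ne_zero_of_le hab hy⟩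

theorem varSet_upper {V : Type} (A : Set V) : IsUpperSet (varSet A) := by
  rintro a b hab ⟨v, hv, h⟩
  exact ⟨v, hv, ne_zero_of_le hab h⟩

theorem add_single_ne {V : Type} (a : V →₀ ℕ) (v x : V) :
    (a + Finsupp.single v 1 : V →₀ ℕ) x ≠ 0 ↔ a x ≠ 0 ∨ x = v := by
  classical
  rw [Finsupp.add_apply, Finsupp.single_apply]
  split_ifs with h
  · simp [h]
  · simp [Ne.symm h]

theorem vertex_split {V K : Type} [Field K] (H : SimpleGraph V) (A : Set V) (v : V) (hv : v ∉ A)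
    (rs : List (MvPolynomial V K)) (h1 : WR (MI K (St H (A ∪ H.neighborSet v))) rs)
    (h2 : WR (MI K (St H (insert v A))) rs) : WR (MI K (St H A)) rs := by
  refine reg_split (St_upper H A) (Finsupp.single v 1) rs ?_ ?_
  · convert h1 using 2
    ext a
    simp only [St, Set.mem_ofPred_eq, add_single_ne, Set.mem_union, SimpleGraph.mem_neighborSet]
    constructor
    · rintro (⟨x, hx, h | rfl⟩ | ⟨x, y, hxy, hx | rfl, hy | rfl⟩)
      · exact Or.inl ⟨x, Or.inl hx, h⟩
      · exact absurd hx hv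
      · exact Or.inr ⟨x, y, hxy, hx, hy⟩
      · exact Or.inl ⟨x, Or.inr hxy.symm, hx⟩
      · exact Or.inl ⟨y, Or.inr hxy, hy⟩
      · exact absurd hxy (H.loopless.irrefl _)
    · rintro (⟨x, hx | hx, h⟩ | ⟨x, y, hxy, hx, hy⟩)
      · exact Or.inl ⟨x, hx, Or.inl h⟩
      · exact Or.inr ⟨v, x, hx, Or.inr rfl, Or.inl h⟩
      · exact Or.inr ⟨x, y, hxy, Or.inl hx, Or.inl hy⟩
  · convert h2 using 2
    ext a
    simp only [St, Set.mem_ofPred_eq, Set.mem_union, Set.mem_Ici, Set.mem_insert_iff,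
      Finsupp.single_le_iff]
    constructor
    · rintro ((⟨x, hx, h⟩ | h) | h)
      · exact Or.inl ⟨x, Or.inr hx, h⟩
      · exact Or.inr h
      · exact Or.inl ⟨v, Or.inl rfl, by omega⟩
    · rintro (⟨x, rfl | hx, h⟩ | h)
      · exact Or.inr (by omega)
      · exact Or.inl (Or.inl ⟨x, hx, h⟩)
      · exact Or.inl (Or.inr h)

/-- Every block other than possibly `b` has a center. -/
def Centered {V : Type} (H : SimpleGraph V) (A : Set V) (B : V → Set V) (s : Finset V) (b : V) :
    Prop :=
  ∀ i ∈ s, i ≠ b → ∃ c ∈ B i, c ∉ A ∧ ∀ w, H.Adj c w → w ∈ B i ∨ w ∈ A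

theorem centered_reg {V K : Type} [Finite V] [Field K] (H : SimpleGraph V) (B : V → Set V)
    (s : Finset V) (b : V) (hB : ∀ i ∈ s, ∀ j ∈ s, ∀ x, x ∈ B i → x ∈ B j → i = j)
    (rs : List (MvPolynomial V K))
    (hbase : ∀ A b, (∀ i ∈ s, i ≠ b → ∃ c ∈ B i, c ∉ A) → WR (MI K (varSet A)) rs) :
    ∀ A : Set V, Centered H A B s b → WR (MI K (St H A)) rs := by
  intro A
  induction A using WellFoundedGT.induction with
  | ind A ih =>
  intro hA
  have hA' := hA
  choose! c hcB hcA hcN using hA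
  by_cases h : ∃ v, v ∉ A ∧ (∀ i ∈ s, i ≠ b → c i ≠ v) ∧ ∃ w, w ∉ A ∧ H.Adj v w
  · obtain ⟨v, hv, hvc, w, hw, hvw⟩ := h
    refine vertex_split H A v hv rs (ih _ ?_ ?_) (ih _ ?_ ?_)
    · exact Set.ssubset_iff_exists.2 ⟨Set.subset_union_left, w, Or.inr hvw, hw⟩
    · intro i hi hib
      by_cases hvi : v ∈ B i
      · refine ⟨v, hvi, ?_, fun w hw => Or.inr (Or.inr hw)⟩
        rintro (h | h)
        · exact hv h
        · exact H.loopless.irrefl _ h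
      · refine ⟨c i, hcB i hi hib, ?_, ?_⟩
        · rintro (h | h)
          · exact hcA i hi hib h
          · rcases hcN i hi hib v (H.adj_symm h) with h | h
            · exact hvi h
            · exact hv h
        · intro w hw
          rcases hcN i hi hib w hw with h | h
          · exact Or.inl h
          · exact Or.inr (Or.inl h)
    · exact Set.ssubset_insert hv
    · intro i hi hib
      refine ⟨c i, hcB i hi hib, ?_, ?_⟩
      · rintro (h | h)
        · exact hvc i hi hib h
        · exact hcA i hi hib h
      · intro w hw
        rcases hcN i hi hib w hw with h | h
        · exact Or.inl h
        · exact Or.inr (Or.inr h)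
  · have : St H A = varSet A := by
      ext a
      constructor
      · rintro (h1 | ⟨x, y, hxy, hx, hy⟩)
        · exact h1
        · by_contra hn
          have hxA : x ∉ A := fun h' => hn ⟨x, h', hx⟩
          have hyA : y ∉ A := fun h' => hn ⟨y, h', hy⟩
          have hcx : ∃ i ∈ s, i ≠ b ∧ c i = x := by
            by_contra hc
            push Not at hc
            exact h ⟨x, hxA, hc, y, hyA, hxy⟩
          have hcy : ∃ i ∈ s, i ≠ b ∧ c i = y := by
            by_contra hc
            push Not at hc
            exact h ⟨y, hyA, hc, x, hxA, hxy.symm⟩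
          obtain ⟨i, hi, hib, rfl⟩ := hcx
          obtain ⟨j, hj, hjb, rfl⟩ := hcy
          rcases hcN i hi hib _ hxy with h' | h'
          · have := hB i hi j hj _ h' (hcB j hj hjb)
            subst this
            exact H.loopless.irrefl _ hxy
          · exact hyA h'
      · exact fun h1 => Or.inl h1
    rw [this]
    refine hbase A b fun i hi hib => ?_
    obtain ⟨c, h1, h2, -⟩ := hA' i hi hib
    exact ⟨c, h1, h2⟩

theorem base_reg {V K : Type} [Fintype V] [Field K] (B : V → Set V) (x0 : V) (l : List V)
    (hl : (x0 :: l).Nodup)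
    (hB : ∀ i ∈ x0 :: l, ∀ j ∈ x0 :: l, ∀ x, x ∈ B i → x ∈ B j → i = j) (A : Set V) (b : V)
    (hc : ∀ i ∈ x0 :: l, i ≠ b → ∃ c ∈ B i, c ∉ A) :
    WR (MI K (varSet A))
      (l.map fun i => linF ((B i).indicator (1 : V → K) - (B x0).indicator (1 : V → K))) := by
  classical
  let L : Submodule K (V → K) :=
    { carrier := {c | ∀ v, v ∉ A → c v = 0}
      zero_mem' := by intro v _; rfl
      add_mem' := by
        intro c d h1 h2 v hv
        rw [Pi.add_apply, h1 v hv, h2 v hv, add_zero]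
      smul_mem' := by
        intro k c h1 v hv
        rw [Pi.smul_apply, h1 v hv, smul_zero] }
  have hL : MI K (varSet A) = linI L := by
    apply le_antisymm
    · intro x hx
      have : x ∈ Ideal.span (X '' A : Set (MvPolynomial V K)) := by
        rw [mem_ideal_span_X_image]
        intro m hm
        exact (mem_MI (varSet_upper A)).1 hx m (mem_support_iff.1 hm)
      refine (Ideal.span_le.2 ?_) this
      rintro _ ⟨v, hv, rfl⟩
      refine Ideal.subset_span ⟨Pi.single v 1, ?_, linF_single v⟩
      intro w hw
      rw [Pi.single_eq_of_ne]
      rintro rfl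
      exact hw hv
    · rw [linI, Ideal.span_le]
      rintro _ ⟨c, hc, rfl⟩
      rw [linF, Fintype.linearCombination_apply]
      refine Ideal.sum_mem _ fun v _ => ?_
      by_cases hv : v ∈ A
      · rw [smul_eq_C_mul]
        refine Ideal.mul_mem_left _ _ (Ideal.subset_span ⟨Finsupp.single v 1, ⟨v, hv, by simp⟩, rfl⟩)
      · rw [hc v hv, zero_smul]
        exact Ideal.zero_mem _
  rw [hL]
  rw [List.nodup_cons] at hl
  choose! c hcB hcA using hc
  have ind : ∀ i ∈ x0 :: l, i ≠ b → ∀ j ∈ x0 :: l,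
      (B j).indicator (1 : V → K) (c i) = if j = i then 1 else 0 := by
    intro i hi hib j hj
    split_ifs with h
    · subst h
      simp [hcB j hj hib]
    · rw [Set.indicator_of_notMem]
      exact fun h' => h (hB j hj i hi _ h' (hcB i hi hib))
  refine wr_linI (fun i => (B i).indicator (1 : V → K) - (B x0).indicator (1 : V → K)) l L hl.2 ?_
  intro j hj
  have hj' : j ∈ x0 :: l := by simp [hj]
  have h0 : x0 ∈ x0 :: l := by simp
  have hne : x0 ≠ j := by rintro rfl; exact hl.1 hj
  by_cases hjb : j = b
  · refine ⟨∑ i ∈ (x0 :: l).toFinset.erase b, LinearMap.proj (c i), ?_, ?_, ?_⟩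
    · intro d hd
      rw [LinearMap.sum_apply]
      refine Finset.sum_eq_zero fun i hi => ?_
      rw [Finset.mem_erase, List.mem_toFinset] at hi
      exact hd _ (hcA i hi.2 hi.1)
    all_goals
      have key : ∀ k ∈ x0 :: l, (∑ i ∈ (x0 :: l).toFinset.erase b,
          LinearMap.proj (R := K) (φ := fun _ : V => K) (c i))
          ((B k).indicator (1 : V → K)) = if k = b then 0 else 1 := by
        intro k hk
        rw [LinearMap.sum_apply]
        have : ∀ i ∈ (x0 :: l).toFinset.erase b,
            LinearMap.proj (R := K) (φ := fun _ : V => K) (c i) ((B k).indicator (1 : V → K)) =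
              if k = i then 1 else 0 := by
          intro i hi
          rw [Finset.mem_erase, List.mem_toFinset] at hi
          exact ind i hi.2 hi.1 k hk
        rw [Finset.sum_congr rfl this, Finset.sum_ite_eq]
        by_cases hkb : k = b
        · simp [hkb]
        · rw [if_pos (Finset.mem_erase.2 ⟨hkb, List.mem_toFinset.2 hk⟩), if_neg hkb]
    · intro k hk hkj
      rw [map_sub, key k (by simp [hk]), key x0 h0, if_neg (hjb ▸ hkj), if_neg (hjb ▸ hne), sub_self]
    · rw [map_sub, key j hj', key x0 h0, if_pos hjb, if_neg (hjb ▸ hne)]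
      simp
  · refine ⟨LinearMap.proj (c j), fun d hd => hd _ (hcA j hj' hjb), ?_, ?_⟩
    · intro k hk hkj
      rw [LinearMap.proj_apply, Pi.sub_apply, ind j hj' hjb k (by simp [hk]), ind j hj' hjb x0 h0,
        if_neg hkj, if_neg hne, sub_self]
    · rw [LinearMap.proj_apply, Pi.sub_apply, ind j hj' hjb j hj', ind j hj' hjb x0 h0,
        if_pos rfl, if_neg hne]
      simp

/-- Exponents of monomials in the square of the edge ideal. -/
def U2 {V : Type} (G : SimpleGraph V) : Set (V →₀ ℕ) :=
  {a | ∃ x y p q, G.Adj x y ∧ G.Adj p q ∧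
    Finsupp.single x 1 + Finsupp.single y 1 + (Finsupp.single p 1 + Finsupp.single q 1) ≤ a}

/-- Exponents of monomials in the square of the edge ideal plus the edges in `T`. -/
def UT {V : Type} (G : SimpleGraph V) (T : Set (Sym2 V)) : Set (V →₀ ℕ) :=
  {a | a ∈ U2 G ∨ ∃ x y, s(x, y) ∈ T ∧ a x ≠ 0 ∧ a y ≠ 0}

theorem UT_upper {V : Type} (G : SimpleGraph V) (T : Set (Sym2 V)) : IsUpperSet (UT G T) := by
  rintro a b hab (⟨x, y, p, q, h1, h2, h3⟩ | ⟨x, y, hxy, hx, hy⟩)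
  · exact Or.inl ⟨x, y, p, q, h1, h2, h3.trans hab⟩
  · exact Or.inr ⟨x, y, hxy, ne_zero_of_le hab hx, ne_zero_of_le hab hy⟩

/-- The graph of the colon ideal `I(G)² : x_u x_v`. -/
def colonGraph {V : Type} (G : SimpleGraph V) (u v : V) : SimpleGraph V :=
  SimpleGraph.fromRel fun x y => G.Adj x y ∨ (G.Adj u x ∧ G.Adj v y)

theorem colonGraph_adj {V : Type} (G : SimpleGraph V) (u v x y : V) :
    (colonGraph G u v).Adj x y ↔
      x ≠ y ∧ (G.Adj x y ∨ (G.Adj u x ∧ G.Adj v y) ∨ (G.Adj v x ∧ G.Adj u y)) := by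
  rw [colonGraph, SimpleGraph.fromRel_adj, G.adj_comm y x]
  tauto

theorem colon_forward {V : Type} (G : SimpleGraph V)
    (htri : ∀ x y z, G.Adj x y → G.Adj y z → G.Adj x z → False) (u v : V) (huv : G.Adj u v)
    (a : V →₀ ℕ) (x y p q : V) (hxy : G.Adj x y) (hpq : G.Adj p q)
    (h : Finsupp.single x 1 + Finsupp.single y 1 + (Finsupp.single p 1 + Finsupp.single q 1) ≤
      a + (Finsupp.single u 1 + Finsupp.single v 1)) :
    ∃ x y, (colonGraph G u v).Adj x y ∧ a x ≠ 0 ∧ a y ≠ 0 := by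
  classical
  by_contra hno
  push Not at hno
  have h1 : ∀ x y, G.Adj x y → a x ≠ 0 → a y = 0 := fun x y hxy =>
    hno x y ((colonGraph_adj G u v x y).2 ⟨hxy.ne, Or.inl hxy⟩)
  have h2 : ∀ x y, G.Adj u x → G.Adj v y → a x ≠ 0 → a y = 0 := fun x y hx hy =>
    hno x y ((colonGraph_adj G u v x y).2
      ⟨by rintro rfl; exact htri _ _ _ huv hy hx, Or.inr (Or.inl ⟨hx, hy⟩)⟩)
  have h' : ∀ z, ((if x = z then 1 else 0) + if y = z then 1 else 0) +
      ((if p = z then 1 else 0) + if q = z then 1 else 0) ≤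
      a z + ((if u = z then 1 else 0) + if v = z then 1 else 0) := by
    intro z
    have := h z
    simpa only [Finsupp.add_apply, Finsupp.single_apply] using this
  clear h hno htri
  have key : ∀ t y r q, (t = u ∨ t = v) → (r = u ∨ r = v) → G.Adj t y → G.Adj r q →
      (∀ z, ((if t = z then 1 else 0) + if y = z then 1 else 0) +
        ((if r = z then 1 else 0) + if q = z then 1 else 0) ≤
        a z + ((if u = z then 1 else 0) + if v = z then 1 else 0)) → False := by
    intro t y r q ht hr hty hrq hz
    have n1 := hty.ne
    have n2 := hrq.ne
    have n3 := huv.ne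
    have e1 := h1 _ _ hty
    have e2 := h1 _ _ hrq
    have hzt := hz t
    have hzr := hz r
    have hzy := hz y
    have hzq := hz q
    clear hz h1
    rcases ht with rfl | rfl <;> rcases hr with rfl | rfl
    · clear h2; grind
    · have e3 := h2 _ _ hty hrq
      clear h2; grind
    · have e3 := h2 _ _ hrq hty
      clear h2; grind
    · clear h2; grind
  have hout : ∀ x y p q, G.Adj x y → 
      (∀ z, ((if x = z then 1 else 0) + if y = z then 1 else 0) +
        ((if p = z then 1 else 0) + if q = z then 1 else 0) ≤
        a z + ((if u = z then 1 else 0) + if v = z then 1 else 0)) →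
      (x = u ∨ x = v) ∨ (y = u ∨ y = v) := by
    intro x y p q hxy hz
    by_contra hc
    push Not at hc
    have hx := hz x
    have hy := hz y
    rw [if_neg (Ne.symm hc.1.1), if_neg (Ne.symm hc.1.2), if_pos rfl] at hx
    rw [if_neg (Ne.symm hc.2.1), if_neg (Ne.symm hc.2.2), if_pos rfl] at hy
    exact absurd (h1 x y hxy (by omega)) (by omega)
  rcases hout x y p q hxy h' with hx | hy <;>
    rcases hout p q x y hpq (fun z => by have := h' z; omega) with hp | hq
  · exact key x y p q hx hp hxy hpq h'
  · exact key x y q p hx hq hxy hpq.symm (fun z => by have := h' z; omega)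
  · exact key y x p q hy hp hxy.symm hpq (fun z => by have := h' z; omega)
  · exact key y x q p hy hq hxy.symm hpq.symm (fun z => by have := h' z; omega)

theorem colon_eq {V : Type} (G : SimpleGraph V)
    (htri : ∀ x y z, G.Adj x y → G.Adj y z → G.Adj x z → False) (T : Set (Sym2 V))
    (hT : T ⊆ G.edgeSet) (u v : V) (huv : G.Adj u v) (huvT : s(u, v) ∉ T) :
    {a | a + (Finsupp.single u 1 + Finsupp.single v 1) ∈ UT G T} =
      St (colonGraph G u v) {w | s(w, u) ∈ T ∨ s(w, v) ∈ T} := by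
  classical
  have hne : ∀ (a : V →₀ ℕ) x,
      (a + (Finsupp.single u 1 + Finsupp.single v 1) : V →₀ ℕ) x ≠ 0 ↔ a x ≠ 0 ∨ x = u ∨ x = v := by
    intro a x
    rw [← add_assoc, add_single_ne, add_single_ne, or_assoc]
  ext a
  constructor
  · rintro (⟨x, y, p, q, hxy, hpq, h⟩ | ⟨x, y, hxy, hx, hy⟩)
    · exact Or.inr (colon_forward G htri u v huv a x y p q hxy hpq h)
    · have hadj : G.Adj x y := hT hxy
      rw [hne] at hx hy
      have hT' : s(y, x) ∈ T := by rwa [Sym2.eq_swap]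
      have hvu : s(v, u) ∉ T := by rwa [Sym2.eq_swap]
      rcases hx with hx | rfl | rfl <;> rcases hy with hy | rfl | rfl
      · exact Or.inr ⟨x, y, (colonGraph_adj ..).2 ⟨hadj.ne, Or.inl hadj⟩, hx, hy⟩
      · exact Or.inl ⟨x, Or.inl hxy, hx⟩
      · exact Or.inl ⟨x, Or.inr hxy, hx⟩
      · exact Or.inl ⟨y, Or.inl hT', hy⟩
      · exact absurd hadj (G.loopless.irrefl _)
      · exact absurd hxy huvT
      · exact Or.inl ⟨y, Or.inr hT', hy⟩
      · exact absurd hxy hvu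
      · exact absurd hadj (G.loopless.irrefl _)
  · rintro (⟨w, hw | hw, h⟩ | ⟨x, y, hxy, hx, hy⟩)
    · exact Or.inr ⟨w, u, hw, (hne ..).2 (Or.inl h), (hne ..).2 (by simp)⟩
    · exact Or.inr ⟨w, v, hw, (hne ..).2 (Or.inl h), (hne ..).2 (by simp)⟩
    · rw [colonGraph_adj] at hxy
      obtain ⟨hxy', hxy⟩ := hxy
      have hle : Finsupp.single x 1 + Finsupp.single y 1 ≤ a := by
        intro z
        rw [Finsupp.add_apply, Finsupp.single_apply, Finsupp.single_apply]
        split_ifs with h1 h2 h2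
        · exact absurd (h1.trans h2.symm) hxy'
        · subst h1; omega
        · subst h2; omega
        · omega
      have hle' := add_le_add_left hle (Finsupp.single u 1 + Finsupp.single v 1)
      rcases hxy with h | ⟨h1, h2⟩ | ⟨h1, h2⟩
      · exact Or.inl ⟨x, y, u, v, h, huv, hle'⟩
      · refine Or.inl ⟨u, x, v, y, h1, h2, le_trans (le_of_eq ?_) hle'⟩
        abel
      · refine Or.inl ⟨v, x, u, y, h1, h2, le_trans (le_of_eq ?_) hle'⟩
        abel

theorem union_eq {V : Type} (G : SimpleGraph V) (T : Set (Sym2 V)) (u v : V) (huv : u ≠ v) :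
    UT G T ∪ Set.Ici (Finsupp.single u 1 + Finsupp.single v 1) = UT G (insert s(u, v) T) := by
  classical
  have hle : ∀ a : V →₀ ℕ, Finsupp.single u 1 + Finsupp.single v 1 ≤ a ↔ a u ≠ 0 ∧ a v ≠ 0 := by
    intro a
    constructor
    · intro h
      exact ⟨ne_zero_of_le h (by simp), ne_zero_of_le h (by simp)⟩
    · rintro ⟨hu, hv⟩ z
      rw [Finsupp.add_apply, Finsupp.single_apply, Finsupp.single_apply]
      split_ifs with h1 h2 h2
      · exact absurd (h1.trans h2.symm) huv
      · subst h1; omega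
      · subst h2; omega
      · omega
  ext a
  rw [Set.mem_union, Set.mem_Ici, hle]
  constructor
  · rintro ((h | ⟨x, y, hxy, h⟩) | h)
    · exact Or.inl h
    · exact Or.inr ⟨x, y, Or.inr hxy, h⟩
    · exact Or.inr ⟨u, v, Or.inl rfl, h⟩
  · rintro (h | ⟨x, y, hxy | hxy, h⟩)
    · exact Or.inl (Or.inl h)
    · rcases Sym2.eq_iff.1 hxy with ⟨rfl, rfl⟩ | ⟨rfl, rfl⟩
      · exact Or.inr h
      · exact Or.inr h.symm
    · exact Or.inl (Or.inr ⟨x, y, hxy, h⟩)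

theorem UT_all {V : Type} (G : SimpleGraph V) : UT G G.edgeSet = St G ∅ := by
  ext a
  constructor
  · rintro (⟨x, y, p, q, hxy, hpq, h⟩ | ⟨x, y, hxy, h⟩)
    · exact Or.inr ⟨x, y, hxy, ne_zero_of_le h (by simp), ne_zero_of_le h (by simp)⟩
    · exact Or.inr ⟨x, y, hxy, h⟩
  · rintro (⟨x, hx, _⟩ | ⟨x, y, hxy, h⟩)
    · exact absurd hx (Set.notMem_empty x)
    · exact Or.inr ⟨x, y, hxy, h⟩

theorem UT_empty {V : Type} (G : SimpleGraph V) : UT G ∅ = U2 G := by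
  ext a
  simp [UT]

theorem MI_U2 {V K : Type} [Field K] (G : SimpleGraph V) : edgeIdeal K G ^ 2 = MI K (U2 G) := by
  have hmon : ∀ x y p q : V, (X x * X y * (X p * X q) : MvPolynomial V K) =
      monomial (Finsupp.single x 1 + Finsupp.single y 1 +
        (Finsupp.single p 1 + Finsupp.single q 1)) 1 := by
    intro x y p q
    simp [X, monomial_mul]
  apply le_antisymm
  · rw [pow_two, edgeIdeal, Ideal.span_mul_span', Ideal.span_le]
    rintro _ ⟨_, ⟨x, y, hxy, rfl⟩, _, ⟨p, q, hpq, rfl⟩, rfl⟩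
    exact Ideal.subset_span ⟨_, ⟨x, y, p, q, hxy, hpq, le_rfl⟩, (hmon x y p q).symm⟩
  · rw [MI, Ideal.span_le]
    rintro _ ⟨a, ⟨x, y, p, q, hxy, hpq, h⟩, rfl⟩
    have : (X x * X y * (X p * X q) : MvPolynomial V K) ∈ edgeIdeal K G ^ 2 := by
      rw [pow_two]
      exact Ideal.mul_mem_mul (Ideal.subset_span ⟨x, y, hxy, rfl⟩)
        (Ideal.subset_span ⟨p, q, hpq, rfl⟩)
    rw [hmon] at this
    exact Ideal.mem_of_dvd _ (monomial_dvd_monomial.2 ⟨Or.inr h, dvd_rfl⟩) this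

theorem mem_closedNbhd {V : Type} {G : SimpleGraph V} {x y : V} :
    y ∈ closedNbhd G x ↔ y = x ∨ G.Adj x y := by
  simp [closedNbhd]

theorem edge_reg {V K : Type} [Finite V] [Field K] (G : SimpleGraph V)
    (htri : ∀ x y z, G.Adj x y → G.Adj y z → G.Adj x z → False) (s : Finset V) (x0 : V)
    (hB : ∀ i ∈ s, ∀ j ∈ s, ∀ x, x ∈ closedNbhd G i → x ∈ closedNbhd G j → i = j)
    (rs : List (MvPolynomial V K))
    (hbase : ∀ A b, (∀ i ∈ s, i ≠ b → ∃ c ∈ closedNbhd G i, c ∉ A) → WR (MI K (varSet A)) rs)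
    (W : Set V) (u v : V) (huv : G.Adj u v)
    (hW : ∀ w ∈ W, G.Adj w u ∨ G.Adj w v)
    (hWs : (∀ i ∈ s, i ≠ u ∧ i ≠ v) → ∀ i ∈ s, i ∉ W) :
    WR (MI K (St (colonGraph G u v) W)) rs := by
  classical
  have hself : ∀ i, i ∈ closedNbhd G i := fun i => mem_closedNbhd.2 (Or.inl rfl)
  have hadjB : ∀ i w, G.Adj i w → w ∈ closedNbhd G i := fun i w h => mem_closedNbhd.2 (Or.inr h)
  by_cases hex : ∃ b, ∀ i ∈ s, i ≠ b → u ∉ closedNbhd G i ∧ v ∉ closedNbhd G i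
  · obtain ⟨b, hb⟩ := hex
    refine centered_reg _ (closedNbhd G) s b hB rs hbase W ?_
    intro i hi hib
    obtain ⟨h1, h2⟩ := hb i hi hib
    refine ⟨i, hself i, ?_, ?_⟩
    · intro hiW
      rcases hW i hiW with h | h
      · exact h1 (hadjB _ _ h)
      · exact h2 (hadjB _ _ h)
    · intro w hw
      rw [colonGraph_adj] at hw
      rcases hw.2 with h | ⟨h, -⟩ | ⟨h, -⟩
      · exact Or.inl (hadjB _ _ h)
      · exact absurd (hadjB _ _ h.symm) h1
      · exact absurd (hadjB _ _ h.symm) h2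
  · push Not at hex
    obtain ⟨b1, hb1, b2, hb2, hb12, hu1, hv2⟩ : ∃ b1 ∈ s, ∃ b2 ∈ s, b1 ≠ b2 ∧
        u ∈ closedNbhd G b1 ∧ v ∈ closedNbhd G b2 := by
      by_cases hu : ∃ b1 ∈ s, u ∈ closedNbhd G b1
      · obtain ⟨b1, hb1, hu1⟩ := hu
        obtain ⟨i, hi, hib, h⟩ := hex b1
        have hui : u ∉ closedNbhd G i := fun h' => hib (hB i hi b1 hb1 u h' hu1)
        exact ⟨b1, hb1, i, hi, hib.symm, hu1, h hui⟩
      · push Not at hu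
        obtain ⟨i, hi, -, h⟩ := hex x0
        obtain ⟨j, hj, hji, h'⟩ := hex i
        exact absurd (hB j hj i hi v (h' (hu j hj)) (h (hu i hi))) hji
    have hui : ∀ i ∈ s, G.Adj u i → i = b1 := fun i hi h => hB i hi b1 hb1 u (hadjB _ _ h.symm) hu1
    have hvi : ∀ i ∈ s, G.Adj v i → i = b2 := fun i hi h => hB i hi b2 hb2 v (hadjB _ _ h.symm) hv2
    have hus : ∀ i ∈ s, i ≠ u ∧ i ≠ v := by
      intro i hi
      constructor
      · rintro rfl
        have e1 := hB i hi b1 hb1 i (hself i) hu1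
        have e2 := hB i hi b2 hb2 v (hadjB _ _ huv) hv2
        exact hb12 (e1.symm.trans e2)
      · rintro rfl
        have e1 := hB i hi b1 hb1 u (hadjB _ _ huv.symm) hu1
        have e2 := hB i hi b2 hb2 i (hself i) hv2
        exact hb12 (e1.symm.trans e2)
    have hiW := hWs hus
    have hub1 : G.Adj u b1 := by
      rcases mem_closedNbhd.1 hu1 with h | h
      · exact absurd h.symm (hus b1 hb1).1
      · exact h.symm
    suffices H : ∀ D : Set V, (∀ x ∈ D, x ∈ W ∨ G.Adj u x) →
        (b1 ∈ D → ∀ x, G.Adj u x → x ∈ D) → WR (MI K (St (colonGraph G u v) D)) rs from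
      H W (fun x hx => Or.inl hx) (fun h => absurd h (hiW b1 hb1))
    intro D
    induction D using WellFoundedGT.induction with
    | ind D ih =>
    intro hD hbD
    by_cases hall : ∀ x, G.Adj u x → x ∈ D
    · refine centered_reg _ (closedNbhd G) s b1 hB rs hbase D ?_
      intro i hi hib
      refine ⟨i, hself i, ?_, ?_⟩
      · intro hiD
        rcases hD i hiD with h | h
        · exact hiW i hi h
        · exact hib (hui i hi h)
      · intro w hw
        rw [colonGraph_adj] at hw
        rcases hw.2 with h | ⟨h, -⟩ | ⟨-, h⟩
        · exact Or.inl (hadjB _ _ h)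
        · exact absurd (hui i hi h) hib
        · exact Or.inr (hall w h)
    · have hb1D : b1 ∉ D := fun h => hall (hbD h)
      obtain ⟨w, huw, hwD, hlast⟩ : ∃ w, G.Adj u w ∧ w ∉ D ∧
          (b1 = w → ∀ x, G.Adj u x → x ∈ insert w D) := by
        by_cases h : ∃ w, G.Adj u w ∧ w ∉ D ∧ w ≠ b1
        · obtain ⟨w, h1, h2, h3⟩ := h
          exact ⟨w, h1, h2, fun h' => absurd h'.symm h3⟩
        · push Not at h
          refine ⟨b1, hub1, hb1D, fun _ x hx => ?_⟩
          by_cases hxD : x ∈ D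
          · exact Or.inr hxD
          · exact Or.inl (h x hx hxD)
      refine vertex_split _ D w hwD rs ?_ (ih _ (Set.ssubset_insert hwD) ?_ ?_)
      · refine centered_reg _ (closedNbhd G) s b2 hB rs hbase _ ?_
        intro i hi hib
        by_cases hwi : w ∈ closedNbhd G i
        · refine ⟨w, hwi, ?_, fun x hx => Or.inr (Or.inr hx)⟩
          rintro (h | h)
          · exact hwD h
          · exact (colonGraph G u v).loopless.irrefl _ h
        · refine ⟨i, hself i, ?_, ?_⟩
          · rintro (h | h)
            · rcases hD i h with h' | h'
              · exact hiW i hi h'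
              · exact hb1D (hui i hi h' ▸ h)
            · rw [SimpleGraph.mem_neighborSet, colonGraph_adj] at h
              rcases h.2 with h | ⟨-, h⟩ | ⟨h, -⟩
              · exact hwi (hadjB _ _ h.symm)
              · exact hib (hvi i hi h)
              · exact htri _ _ _ huv h huw
          · intro x hx
            rw [colonGraph_adj] at hx
            rcases hx.2 with h | ⟨-, h⟩ | ⟨h, -⟩
            · exact Or.inl (hadjB _ _ h)
            · refine Or.inr (Or.inr ?_)
              rw [SimpleGraph.mem_neighborSet, colonGraph_adj]
              refine ⟨?_, Or.inr (Or.inl ⟨huw, h⟩)⟩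
              rintro rfl
              exact htri _ _ _ huv h huw
            · exact absurd (hvi i hi h) hib
      · rintro x (rfl | hx)
        · exact Or.inr huw
        · exact hD x hx
      · rintro (h | h)
        · exact hlast h
        · exact absurd h hb1D

theorem square_reg {V K : Type} [Finite V] [Field K] (G : SimpleGraph V)
    (htri : ∀ x y z, G.Adj x y → G.Adj y z → G.Adj x z → False) (s : Finset V) (x0 : V)
    (hB : ∀ i ∈ s, ∀ j ∈ s, ∀ x, x ∈ closedNbhd G i → x ∈ closedNbhd G j → i = j)
    (rs : List (MvPolynomial V K))
    (hbase : ∀ A b, (∀ i ∈ s, i ≠ b → ∃ c ∈ closedNbhd G i, c ∉ A) → WR (MI K (varSet A)) rs)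
    (T : Set (Sym2 V)) : T ⊆ G.edgeSet →
    ((∃ e ∈ T, ∃ i ∈ s, i ∈ e) → ∀ e ∈ G.edgeSet, (∀ i ∈ s, i ∉ e) → e ∈ T) →
    WR (MI K (UT G T)) rs := by
  classical
  induction T using WellFoundedGT.induction with
  | ind T ih =>
  intro hT hP
  by_cases hall : G.edgeSet ⊆ T
  · rw [Set.Subset.antisymm hT hall, UT_all]
    refine centered_reg _ (closedNbhd G) s x0 hB rs hbase _ ?_
    intro i hi _
    exact ⟨i, mem_closedNbhd.2 (Or.inl rfl), Set.notMem_empty _,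
      fun w hw => Or.inl (mem_closedNbhd.2 (Or.inr hw))⟩
  · obtain ⟨e, heG, heT, he⟩ : ∃ e ∈ G.edgeSet, e ∉ T ∧
        ((∃ i ∈ s, i ∈ e) → ∀ e ∈ G.edgeSet, (∀ i ∈ s, i ∉ e) → e ∈ T) := by
      by_cases h : ∃ e ∈ G.edgeSet, e ∉ T ∧ ∀ i ∈ s, i ∉ e
      · obtain ⟨e, h1, h2, h3⟩ := h
        refine ⟨e, h1, h2, ?_⟩
        rintro ⟨i, hi, hie⟩
        exact absurd hie (h3 i hi)
      · obtain ⟨e, h1, h2⟩ := Set.not_subset.1 hall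
        refine ⟨e, h1, h2, fun _ e' he' hn => ?_⟩
        by_contra hc
        exact h ⟨e', he', hc, hn⟩
    induction e using Sym2.ind with
    | _ u v =>
    have huv : G.Adj u v := heG
    refine reg_split (UT_upper G T) (Finsupp.single u 1 + Finsupp.single v 1) rs ?_ ?_
    · rw [colon_eq G htri T hT u v huv heT]
      refine edge_reg G htri s x0 hB rs hbase _ u v huv ?_ ?_
      · rintro w (h | h)
        · exact Or.inl (hT h)
        · exact Or.inr (hT h)
      · intro hn i hi hiW
        refine heT (hP ?_ _ heG ?_)
        · rcases hiW with h | h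
          · exact ⟨_, h, i, hi, by simp⟩
          · exact ⟨_, h, i, hi, by simp⟩
        · intro j hj hje
          rcases Sym2.mem_iff.1 hje with h | h
          · exact (hn j hj).1 h
          · exact (hn j hj).2 h
    · rw [union_eq G T u v huv.ne]
      refine ih _ (Set.ssubset_insert heT) (Set.insert_subset heG hT) ?_
      rintro ⟨e, rfl | he', hi⟩ e'' h1 h2
      · exact Or.inr (he hi e'' h1 h2)
      · exact Or.inr (hP ⟨e, he', hi⟩ e'' h1 h2)

theorem quot_isRegular {V K : Type} [Field K] (J : Ideal (MvPolynomial V K))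
    (hJ : J ≤ Ideal.span (Set.range (X (R := K) (σ := V)))) (rs : List (MvPolynomial V K))
    (hrs : ∀ r ∈ rs, r ∈ Ideal.span (Set.range (X (R := K) (σ := V)))) (h : WR J rs) :
    RingTheory.Sequence.IsRegular (MvPolynomial V K ⧸ J) rs := by
  refine ⟨wr_isWeaklyRegular rs J h, ?_⟩
  intro htop
  have hm : Ideal.span (Set.range (X (R := K) (σ := V))) ≠ ⊤ := by
    intro ht
    have h1 : (1 : MvPolynomial V K) ∈ Ideal.span (Set.range (X (R := K) (σ := V))) := by
      rw [ht]; trivial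
    have h2 : Ideal.span (Set.range (X (R := K) (σ := V))) ≤
        RingHom.ker (constantCoeff (R := K) (σ := V)) := by
      rw [Ideal.span_le]
      rintro _ ⟨v, rfl⟩
      simp
    have := h2 h1
    simp at this
  have e : (⊤ : Submodule (MvPolynomial V K) (MvPolynomial V K ⧸ J)) =
      Submodule.map J.mkQ ⊤ := by
    rw [Submodule.map_top, Submodule.range_mkQ]
  have h1 : J.mkQ 1 ∈ Ideal.ofList rs • (⊤ : Submodule (MvPolynomial V K) (MvPolynomial V K ⧸ J)) := by
    rw [← htop]; trivial
  rw [e, ← Submodule.map_smul''] at h1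
  obtain ⟨y, hy, hy1⟩ := h1
  have hy2 : y ∈ Ideal.span (Set.range (X (R := K) (σ := V))) := by
    have : Ideal.ofList rs ≤ Ideal.span (Set.range (X (R := K) (σ := V))) :=
      Ideal.span_le.2 hrs
    apply this
    simpa using hy
  have hy3 : y - 1 ∈ J := (Submodule.Quotient.eq J).1 hy1
  apply hm
  rw [Ideal.eq_top_iff_one]
  have := Ideal.sub_mem _ hy2 (hJ hy3)
  simpa using this

theorem quotDepth_ge {V : Type} [Fintype V] (K : Type) [Field K]
    (J : Ideal (MvPolynomial V K)) (rs : List (MvPolynomial V K))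
    (h1 : ∀ r ∈ rs, r ∈ Ideal.span (Set.range (X (R := K) (σ := V))))
    (h2 : RingTheory.Sequence.IsRegular (MvPolynomial V K ⧸ J) rs) :
    rs.length ≤ quotDepth K J := by
  refine le_csSup ⟨Nat.card V, ?_⟩ ⟨rs, rfl, h1, h2⟩
  rintro n ⟨rs', rfl, -, h⟩
  have h3 := (isRegular_length_le rs' _ h).trans (Module.supportDim_le_ringKrullDim _ _)
  rw [MvPolynomial.ringKrullDim_of_isNoetherianRing, ringKrullDim_eq_zero_of_field, zero_add] at h3
  exact_mod_cast h3

/-- For any triangle-free graph `G`, `depth_S I(G)² ≥ α₂(G)`, where the depth of the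
ideal `I(G)²` is `depth_S(S/I(G)²) + 1`. -/
theorem depth_second_power_ge_of_triangleFree {V : Type} [Fintype V] (K : Type) [Field K]
    (G : SimpleGraph V) (hfree : G.CliqueFree 3) :
    starPackingNumber G ≤ quotDepth K (edgeIdeal K G ^ 2) + 1 := by
  classical
  have htri : ∀ x y z, G.Adj x y → G.Adj y z → G.Adj x z → False := by
    intro x y z h1 h2 h3
    exact hfree {x, y, z} (SimpleGraph.is3Clique_triple_iff.2 ⟨h1, h3, h2⟩)
  refine csSup_le' ?_
  rintro n ⟨s, hs, rfl⟩
  have hB : ∀ i ∈ s, ∀ j ∈ s, ∀ x, x ∈ closedNbhd G i → x ∈ closedNbhd G j → i = j := by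
    intro i hi j hj x hx hx'
    by_contra hne
    exact Set.disjoint_left.1 (hs hi hj hne) hx hx'
  rcases hsl : s.toList with _ | ⟨x0, l⟩
  · rw [Finset.toList_eq_nil] at hsl
    simp [hsl]
  have hmem : ∀ i, i ∈ s ↔ i ∈ x0 :: l := by
    intro i
    rw [← hsl, Finset.mem_toList]
  have hcard : s.card = l.length + 1 := by
    rw [← Finset.length_toList, hsl, List.length_cons]
  have hnd : (x0 :: l).Nodup := hsl ▸ s.nodup_toList
  let rs : List (MvPolynomial V K) := l.map fun i =>
    linF ((closedNbhd G i).indicator (1 : V → K) - (closedNbhd G x0).indicator (1 : V → K))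
  have hrs : ∀ r ∈ rs, r ∈ Ideal.span (Set.range (X (R := K) (σ := V))) := by
    intro r hr
    obtain ⟨i, -, rfl⟩ := List.mem_map.1 hr
    exact linF_mem _
  have hwr : WR (edgeIdeal K G ^ 2) rs := by
    rw [MI_U2, ← UT_empty]
    refine square_reg G htri s x0 hB rs ?_ ∅ (Set.empty_subset _) ?_
    · intro A b hc
      refine base_reg (closedNbhd G) x0 l hnd ?_ A b ?_
      · intro i hi j hj
        exact hB i ((hmem i).2 hi) j ((hmem j).2 hj)
      · intro i hi
        exact hc i ((hmem i).2 hi)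
    · rintro ⟨e, he, -⟩
      exact absurd he (Set.notMem_empty e)
  have hJ : edgeIdeal K G ^ 2 ≤ Ideal.span (Set.range (X (R := K) (σ := V))) := by
    refine (Ideal.pow_le_self two_ne_zero).trans ?_
    rw [edgeIdeal, Ideal.span_le]
    rintro _ ⟨x, y, -, rfl⟩
    exact Ideal.mul_mem_right _ _ (Ideal.subset_span ⟨x, rfl⟩)
  have := quotDepth_ge K _ rs hrs (quot_isRegular _ hJ rs hrs hwr)
  rw [hcard]
  simpa [rs] using this
end

section
/- Let G be the path P_4 on four vertices x1–x2–x3–x4, with edge ideal I(G) = (x1x2, x2x3, x3x4) ⊆ S = K[x1,x2,x3,x4]. Then depth_S I(G)^2 = 2 and α₂(G) = 2, so depth_S I(G)^2 = α₂(G), showing the bound for triangle-free graphs is sharp. -/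
open MvPolynomial

/-- The path `P₄` on four vertices `0 - 1 - 2 - 3`. -/
def pathFour : SimpleGraph (Fin 4) :=
  SimpleGraph.fromEdgeSet {s(0, 1), s(1, 2), s(2, 3)}

/-- Polynomials all of whose monomials have degree at least two in `x_i, x_j`. -/
def QQ (K : Type) [Field K] (i j : Fin 4) : Ideal (MvPolynomial (Fin 4) K) where
  carrier := {f | ∀ m : Fin 4 →₀ ℕ, m i + m j < 2 → coeff m f = 0}
  zero_mem' := by intro m _; simp
  add_mem' := by
    intro f g hf hg m hm
    rw [coeff_add, hf m hm, hg m hm, add_zero]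
  smul_mem' := by
    intro c f hf m hm
    rw [smul_eq_mul, coeff_mul]
    refine Finset.sum_eq_zero fun p hp => ?_
    rw [Finset.HasAntidiagonal.mem_antidiagonal] at hp
    have h1 : p.1 i + p.2 i = m i := by rw [← hp]; rfl
    have h2 : p.1 j + p.2 j = m j := by rw [← hp]; rfl
    rw [hf p.2 (by omega), mul_zero]

theorem mem_QQ {K : Type} [Field K] {i j : Fin 4} {f : MvPolynomial (Fin 4) K} :
    f ∈ QQ K i j ↔ ∀ m : Fin 4 →₀ ℕ, m i + m j < 2 → coeff m f = 0 := Iff.rfl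

/-- The prime ideal version, through coefficients. -/
theorem X_mul_X_mem_QQ {K : Type} [Field K] {i j x y : Fin 4}
    (hx : x = i ∨ x = j) (hy : y = i ∨ y = j) (hij : i ≠ j) :
    (X x * X y : MvPolynomial (Fin 4) K) ∈ QQ K i j := by
  intro m hm
  rw [X, X, monomial_mul, coeff_monomial, if_neg]
  rintro rfl
  rcases hx with rfl | rfl <;> rcases hy with rfl | rfl <;>
    simp [Finsupp.single_apply, hij, hij.symm] at hm

theorem adj_iff (x y : Fin 4) : pathFour.Adj x y ↔
    (x = 0 ∧ y = 1) ∨ (x = 1 ∧ y = 0) ∨ (x = 1 ∧ y = 2) ∨ (x = 2 ∧ y = 1) ∨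
    (x = 2 ∧ y = 3) ∨ (x = 3 ∧ y = 2) := by
  fin_cases x <;> fin_cases y <;> simp [pathFour]

theorem edge_mem {K : Type} [Field K] {x y : Fin 4} (h : pathFour.Adj x y) :
    (X x * X y : MvPolynomial (Fin 4) K) ∈ edgeIdeal K pathFour :=
  Ideal.subset_span ⟨x, y, h, rfl⟩

theorem sq_le_QQ {K : Type} [Field K] {i j : Fin 4} (hij : i ≠ j)
    (hc : ∀ x y, pathFour.Adj x y → x = i ∨ x = j ∨ y = i ∨ y = j) :
    edgeIdeal K pathFour ^ 2 ≤ QQ K i j := by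
  rw [pow_two, edgeIdeal, Ideal.span_mul_span', Ideal.span_le]
  rintro _ ⟨_, ⟨x, y, hxy, rfl⟩, _, ⟨z, w, hzw, rfl⟩, rfl⟩
  have key : ∀ x y, pathFour.Adj x y →
      ∃ u v : Fin 4, (u = i ∨ u = j) ∧ (X x * X y : MvPolynomial (Fin 4) K) = X u * X v := by
    intro x y h
    rcases hc x y h with h | h | h | h
    · exact ⟨x, y, Or.inl h, rfl⟩
    · exact ⟨x, y, Or.inr h, rfl⟩
    · exact ⟨y, x, Or.inl h, mul_comm _ _⟩
    · exact ⟨y, x, Or.inr h, mul_comm _ _⟩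
  obtain ⟨u, v, hu, e1⟩ := key x y hxy
  obtain ⟨u', v', hu', e2⟩ := key z w hzw
  simp only [e1, e2, SetLike.mem_coe]
  have : (X u * X v * (X u' * X v') : MvPolynomial (Fin 4) K)
      = (X v * X v') * (X u * X u') := by ring
  rw [this]
  exact Ideal.mul_mem_left _ _ (X_mul_X_mem_QQ hu hu' hij)

theorem monomial_mem_of {K : Type} [Field K] {J : Ideal (MvPolynomial (Fin 4) K)}
    (n m : Fin 4 →₀ ℕ) (c : K) (h : n ≤ m) (hn : monomial n (1 : K) ∈ J) :
    monomial m c ∈ J := by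
  have : monomial m c = monomial (m - n) c * monomial n 1 := by
    rw [monomial_mul, tsub_add_cancel_of_le h, mul_one]
  rw [this]
  exact Ideal.mul_mem_left _ _ hn

theorem quad_mem {K : Type} [Field K] {x y z w : Fin 4} (m : Fin 4 →₀ ℕ) (c : K)
    (h : pathFour.Adj x y) (h' : pathFour.Adj z w)
    (hle : ∀ t, (if x = t then 1 else 0) + (if y = t then 1 else 0) +
      ((if z = t then 1 else 0) + (if w = t then 1 else 0)) ≤ m t) :
    monomial m c ∈ edgeIdeal K pathFour ^ 2 := by
  refine monomial_mem_of (Finsupp.single x 1 + Finsupp.single y 1 +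
    (Finsupp.single z 1 + Finsupp.single w 1)) m c ?_ ?_
  · intro t
    simpa [Finsupp.single_apply] using hle t
  · have := Ideal.mul_mem_mul (edge_mem (K := K) h) (edge_mem (K := K) h')
    rw [← pow_two] at this
    simpa [X, monomial_mul] using this

theorem mem_sq_iff {K : Type} [Field K] (f : MvPolynomial (Fin 4) K) :
    f ∈ edgeIdeal K pathFour ^ 2 ↔ f ∈ QQ K 1 2 ∧ f ∈ QQ K 0 2 ∧ f ∈ QQ K 1 3 := by
  constructor
  · intro h
    refine ⟨sq_le_QQ (by decide) ?_ h, sq_le_QQ (by decide) ?_ h, sq_le_QQ (by decide) ?_ h⟩ <;>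
    · intro x y hxy
      rw [adj_iff] at hxy
      omega
  · rintro ⟨h1, h2, h3⟩
    rw [f.as_sum]
    refine Ideal.sum_mem _ fun m hm => ?_
    rw [mem_support_iff] at hm
    have g1 : 2 ≤ m 1 + m 2 := by
      by_contra hh; exact hm (h1 m (by omega))
    have g2 : 2 ≤ m 0 + m 2 := by
      by_contra hh; exact hm (h2 m (by omega))
    have g3 : 2 ≤ m 1 + m 3 := by
      by_contra hh; exact hm (h3 m (by omega))
    have a01 : pathFour.Adj 0 1 := by simp [adj_iff]
    have a12 : pathFour.Adj 1 2 := by simp [adj_iff]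
    have a23 : pathFour.Adj 2 3 := by simp [adj_iff]
    have cases : (2 ≤ m 0 ∧ 2 ≤ m 1) ∨ (1 ≤ m 0 ∧ 2 ≤ m 1 ∧ 1 ≤ m 2) ∨
        (1 ≤ m 0 ∧ 1 ≤ m 1 ∧ 1 ≤ m 2 ∧ 1 ≤ m 3) ∨ (2 ≤ m 1 ∧ 2 ≤ m 2) ∨
        (1 ≤ m 1 ∧ 2 ≤ m 2 ∧ 1 ≤ m 3) ∨ (2 ≤ m 2 ∧ 2 ≤ m 3) := by omega
    rcases cases with h | h | h | h | h | h
    · refine quad_mem m _ a01 a01 ?_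
      intro t; fin_cases t <;> simp <;> omega
    · refine quad_mem m _ a01 a12 ?_
      intro t; fin_cases t <;> simp <;> omega
    · refine quad_mem m _ a01 a23 ?_
      intro t; fin_cases t <;> simp <;> omega
    · refine quad_mem m _ a12 a12 ?_
      intro t; fin_cases t <;> simp <;> omega
    · refine quad_mem m _ a12 a23 ?_
      intro t; fin_cases t <;> simp <;> omega
    · refine quad_mem m _ a23 a23 ?_
      intro t; fin_cases t <;> simp <;> omega

/-- If `(x_p + x_q) f` lies in `QQ i j` and `p` is not among `i, j`, then so does `f`. -/
theorem QQ_cancel {K : Type} [Field K] {i j p q : Fin 4} (hpi : p ≠ i) (hpj : p ≠ j)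
    (hpq : p ≠ q) (f : MvPolynomial (Fin 4) K)
    (h : (X p + X q) * f ∈ QQ K i j) : f ∈ QQ K i j := by
  have key : ∀ n : ℕ, ∀ m : Fin 4 →₀ ℕ, m q = n → m i + m j < 2 → coeff m f = 0 := by
    intro n
    induction n with
    | zero =>
      intro m hq hm
      have := h (Finsupp.single p 1 + m) (by simpa [hpi, hpj] using hm)
      rw [add_mul, coeff_add, coeff_X_mul, coeff_X_mul', if_neg, add_zero] at this
      · exact this
      · simp [hpq, hq]
    | succ n ih =>
      intro m hq hm
      have := h (Finsupp.single p 1 + m) (by simpa [hpi, hpj] using hm)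
      rw [add_mul, coeff_add, coeff_X_mul, coeff_X_mul', if_pos (by simp [hpq, hq]),
        ih (Finsupp.single p 1 + m - Finsupp.single q 1), add_zero] at this
      · exact this
      · simp [hpq, hq]
      · have e1 : (Finsupp.single p 1 + m - Finsupp.single q 1 : Fin 4 →₀ ℕ) i ≤ m i := by
          simp [hpi]
        have e2 : (Finsupp.single p 1 + m - Finsupp.single q 1 : Fin 4 →₀ ℕ) j ≤ m j := by
          simp [hpj]
        omega
  exact fun m hm => key _ m rfl hm

/-- Representatives of `f ξ`, where `ξ` is the class of `x₁x₂` on one component. -/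
theorem exists_rep {K : Type} [Field K] (f : MvPolynomial (Fin 4) K)
    (hf : f ∈ Ideal.span (Set.range (X (R := K) (σ := Fin 4)))) :
    ∃ w, w ∈ QQ K 1 2 ∧ w ∈ QQ K 1 3 ∧ w - f * (X 1 * X 2) ∈ QQ K 0 2 := by
  refine Submodule.span_induction (p := fun f _ => ∃ w, w ∈ QQ K 1 2 ∧ w ∈ QQ K 1 3 ∧
    w - f * (X 1 * X 2) ∈ QQ K 0 2) ?_ ?_ ?_ ?_ hf
  · rintro _ ⟨x, rfl⟩
    have z02 : ∀ p : MvPolynomial (Fin 4) K, (0 : MvPolynomial (Fin 4) K) - p ∈ QQ K 0 2 ↔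
        p ∈ QQ K 0 2 := by intro p; rw [zero_sub, neg_mem_iff]
    fin_cases x
    · refine ⟨0, zero_mem _, zero_mem _, ?_⟩
      rw [z02]
      have : (X 0 * (X 1 * X 2) : MvPolynomial (Fin 4) K) = X 1 * (X 0 * X 2) := by ring
      exact this ▸ Ideal.mul_mem_left _ _ (X_mul_X_mem_QQ (by simp) (by simp) (by decide))
    · refine ⟨X 1 * (X 1 * X 2), Ideal.mul_mem_left _ _
        (X_mul_X_mem_QQ (by simp) (by simp) (by decide)), ?_, ?_⟩
      · have : (X 1 * (X 1 * X 2) : MvPolynomial (Fin 4) K) = X 2 * (X 1 * X 1) := by ring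
        exact this ▸ Ideal.mul_mem_left _ _ (X_mul_X_mem_QQ (by simp) (by simp) (by decide))
      · simp
    · refine ⟨0, zero_mem _, zero_mem _, ?_⟩
      rw [z02]
      have : (X 2 * (X 1 * X 2) : MvPolynomial (Fin 4) K) = X 1 * (X 2 * X 2) := by ring
      exact this ▸ Ideal.mul_mem_left _ _ (X_mul_X_mem_QQ (by simp) (by simp) (by decide))
    · refine ⟨X 3 * (X 1 * X 2), Ideal.mul_mem_left _ _
        (X_mul_X_mem_QQ (by simp) (by simp) (by decide)), ?_, ?_⟩
      · have : (X 3 * (X 1 * X 2) : MvPolynomial (Fin 4) K) = X 2 * (X 1 * X 3) := by ring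
        exact this ▸ Ideal.mul_mem_left _ _ (X_mul_X_mem_QQ (by simp) (by simp) (by decide))
      · simp
  · exact ⟨0, zero_mem _, zero_mem _, by simp⟩
  · rintro f g _ _ ⟨w, h1, h2, h3⟩ ⟨v, g1, g2, g3⟩
    refine ⟨w + v, add_mem h1 g1, add_mem h2 g2, ?_⟩
    have := add_mem h3 g3
    convert this using 1
    ring
  · rintro c f _ ⟨w, h1, h2, h3⟩
    refine ⟨c * w, Ideal.mul_mem_left _ _ h1, Ideal.mul_mem_left _ _ h2, ?_⟩
    have := Ideal.mul_mem_left _ c h3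
    convert this using 1
    rw [smul_eq_mul]
    ring

theorem X_mem_irr {K : Type} [Field K] (x : Fin 4) :
    (X x : MvPolynomial (Fin 4) K) ∈ Ideal.span (Set.range (X (R := K) (σ := Fin 4))) :=
  Ideal.subset_span ⟨x, rfl⟩

theorem smul_mk_eq_zero {K : Type} [Field K] {J : Ideal (MvPolynomial (Fin 4) K)}
    {f h : MvPolynomial (Fin 4) K} (hreg : IsSMulRegular (MvPolynomial (Fin 4) K ⧸ J) f)
    (hh : f * h ∈ J) : h ∈ J := by
  rw [← Ideal.Quotient.eq_zero_iff_mem]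
  apply hreg
  change f • Ideal.Quotient.mk J h = f • 0
  rw [smul_zero, ← Ideal.Quotient.eq_zero_iff_mem.2 hh]
  rfl

/-- No two elements of the irrelevant ideal form a regular sequence. -/
theorem no_reg_pair {K : Type} [Field K] (f g : MvPolynomial (Fin 4) K)
    (hf : f ∈ Ideal.span (Set.range (X (R := K) (σ := Fin 4))))
    (hg : g ∈ Ideal.span (Set.range (X (R := K) (σ := Fin 4))))
    (hreg : IsSMulRegular (MvPolynomial (Fin 4) K ⧸ edgeIdeal K pathFour ^ 2) f)
    (hreg2 : IsSMulRegular
      (QuotSMulTop f (MvPolynomial (Fin 4) K ⧸ edgeIdeal K pathFour ^ 2)) g) : False := by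
  obtain ⟨w, w1, w2, w3⟩ := exists_rep f hf
  obtain ⟨v, v1, v2, v3⟩ := exists_rep g hg
  have hcomm : g * w - f * v ∈ edgeIdeal K pathFour ^ 2 := by
    rw [mem_sq_iff]
    refine ⟨sub_mem (Ideal.mul_mem_left _ _ w1) (Ideal.mul_mem_left _ _ v1), ?_,
      sub_mem (Ideal.mul_mem_left _ _ w2) (Ideal.mul_mem_left _ _ v2)⟩
    have := sub_mem (Ideal.mul_mem_left _ g w3) (Ideal.mul_mem_left _ f v3)
    convert this using 1
    ring
  have hw : (Submodule.Quotient.mk (Ideal.Quotient.mk (edgeIdeal K pathFour ^ 2) w) :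
      QuotSMulTop f (MvPolynomial (Fin 4) K ⧸ edgeIdeal K pathFour ^ 2)) = 0 := by
    apply hreg2
    change g • _ = g • _
    rw [smul_zero, ← Submodule.Quotient.mk_smul, Submodule.Quotient.mk_eq_zero,
      Submodule.mem_smul_pointwise_iff_exists]
    refine ⟨Ideal.Quotient.mk _ v, trivial, ?_⟩
    have := (Ideal.Quotient.eq.2 hcomm)
    exact this.symm
  rw [Submodule.Quotient.mk_eq_zero, Submodule.mem_smul_pointwise_iff_exists] at hw
  obtain ⟨h', -, hh⟩ := hw
  obtain ⟨h, rfl⟩ := Ideal.Quotient.mk_surjective h'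
  have hJ : f * h - w ∈ edgeIdeal K pathFour ^ 2 := Ideal.Quotient.eq.1 hh
  obtain ⟨j1, j2, j3⟩ := (mem_sq_iff _).1 hJ
  have step : ∀ x : Fin 4, (X x : MvPolynomial (Fin 4) K) * h ∈ QQ K 1 3 ∧
      X x * (h - X 1 * X 2) ∈ QQ K 0 2 := by
    intro x
    obtain ⟨u, u1, u2, u3⟩ := exists_rep (X x : MvPolynomial (Fin 4) K) (X_mem_irr x)
    have hm : f * (X x * h - u) ∈ edgeIdeal K pathFour ^ 2 := by
      rw [mem_sq_iff]
      refine ⟨?_, ?_, ?_⟩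
      · have := sub_mem (add_mem (Ideal.mul_mem_left _ (X x) j1)
          (Ideal.mul_mem_left _ (X x) w1)) (Ideal.mul_mem_left _ f u1)
        convert this using 1
        ring
      · have := sub_mem (add_mem (Ideal.mul_mem_left _ (X x) j2)
          (Ideal.mul_mem_left _ (X x) w3)) (Ideal.mul_mem_left _ f u3)
        convert this using 1
        ring
      · have := sub_mem (add_mem (Ideal.mul_mem_left _ (X x) j3)
          (Ideal.mul_mem_left _ (X x) w2)) (Ideal.mul_mem_left _ f u2)
        convert this using 1
        ring
    obtain ⟨k1, k2, k3⟩ := (mem_sq_iff _).1 (smul_mk_eq_zero hreg hm)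
    refine ⟨?_, ?_⟩
    · have := add_mem k3 u2
      convert this using 1
      ring
    · have := add_mem k2 u3
      convert this using 1
      ring
  have c0 := (step 0).1 (Finsupp.single 0 1 + (Finsupp.single 1 1 + Finsupp.single 2 1))
    (by simp [Finsupp.single_apply])
  have c1 := (step 1).2 (Finsupp.single 1 1 + (Finsupp.single 1 1 + Finsupp.single 2 1))
    (by simp [Finsupp.single_apply])
  rw [coeff_X_mul] at c0 c1
  rw [coeff_sub, c0, X, X, monomial_mul, coeff_monomial] at c1
  simp at c1

theorem exists_reg {K : Type} [Field K] :
    RingTheory.Sequence.IsRegular (MvPolynomial (Fin 4) K ⧸ edgeIdeal K pathFour ^ 2)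
      [(X 0 + X 3 : MvPolynomial (Fin 4) K)] := by
  refine ⟨?_, ?_⟩
  · rw [RingTheory.Sequence.isWeaklyRegular_singleton_iff]
    intro a b hab
    obtain ⟨a, rfl⟩ := Ideal.Quotient.mk_surjective a
    obtain ⟨b, rfl⟩ := Ideal.Quotient.mk_surjective b
    have hJ : (X 0 + X 3) * a - (X 0 + X 3) * b ∈ edgeIdeal K pathFour ^ 2 :=
      Ideal.Quotient.eq.1 hab
    rw [← mul_sub, mem_sq_iff] at hJ
    refine Ideal.Quotient.eq.2 ((mem_sq_iff _).2 ⟨?_, ?_, ?_⟩)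
    · exact QQ_cancel (by decide) (by decide) (by decide) _ hJ.1
    · refine QQ_cancel (p := 3) (q := 0) (by decide) (by decide) (by decide) _ ?_
      rw [add_comm]
      exact hJ.2.1
    · exact QQ_cancel (by decide) (by decide) (by decide) _ hJ.2.2
  · intro htop
    rw [Ideal.ofList_singleton] at htop
    have h1 : (Ideal.Quotient.mk (edgeIdeal K pathFour ^ 2) 1) ∈
        (Ideal.span {(X 0 + X 3 : MvPolynomial (Fin 4) K)} •
          (⊤ : Submodule (MvPolynomial (Fin 4) K)
            (MvPolynomial (Fin 4) K ⧸ edgeIdeal K pathFour ^ 2))) := htop ▸ trivial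
    rw [Submodule.ideal_span_singleton_smul,
      Submodule.mem_smul_pointwise_iff_exists] at h1
    obtain ⟨h', -, hh⟩ := h1
    obtain ⟨h, rfl⟩ := Ideal.Quotient.mk_surjective h'
    have hJ : (X 0 + X 3) * h - 1 ∈ edgeIdeal K pathFour ^ 2 := Ideal.Quotient.eq.1 hh
    have := ((mem_sq_iff _).1 hJ).1 0 (by simp)
    rw [← constantCoeff_eq] at this
    simp at this

theorem quotDepth_eq (K : Type) [Field K] :
    quotDepth K (edgeIdeal K pathFour ^ 2) = 1 := by
  refine IsGreatest.csSup_eq ⟨⟨[X 0 + X 3], rfl, ?_, exists_reg⟩, ?_⟩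
  · intro r hr
    rw [List.mem_singleton] at hr
    subst hr
    exact add_mem (X_mem_irr 0) (X_mem_irr 3)
  · rintro n ⟨rs, rfl, hrs, hreg⟩
    match rs, hrs, hreg with
    | [], _, _ => simp
    | [_], _, _ => simp
    | f :: g :: l, hrs, hreg =>
      exfalso
      have hw := hreg.toIsWeaklyRegular
      rw [RingTheory.Sequence.isWeaklyRegular_cons_iff,
        RingTheory.Sequence.isWeaklyRegular_cons_iff] at hw
      exact no_reg_pair f g (hrs f (by simp)) (hrs g (by simp)) hw.1 hw.2.1

theorem starPacking_eq : starPackingNumber pathFour = 2 := by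
  refine IsGreatest.csSup_eq ⟨⟨{0, 3}, ?_, rfl⟩, ?_⟩
  · intro x hx y hy hxy
    rw [Set.disjoint_left]
    intro t h1 h2
    simp only [closedNbhd, Set.mem_insert_iff, SimpleGraph.mem_neighborSet, adj_iff] at h1 h2
    simp at hx hy
    omega
  · rintro n ⟨s, hs, rfl⟩
    have hcard := Finset.card_le_card_of_injOn (s := s) (t := ({1, 2} : Finset (Fin 4)))
      (fun x => if x = 0 ∨ x = 1 then 1 else 2) (by intro x _; dsimp only; split_ifs <;> simp) ?_
    · simpa using hcard
    · intro x hx y hy hxy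
      by_contra hne
      have hd := Set.disjoint_left.1 (hs hx hy hne)
      have : ∀ x : Fin 4, (if x = 0 ∨ x = 1 then (1 : Fin 4) else 2) ∈ closedNbhd pathFour x := by
        intro x
        simp only [closedNbhd, Set.mem_insert_iff, SimpleGraph.mem_neighborSet, adj_iff]
        fin_cases x <;> simp
      have hy' := this y
      dsimp only at hxy
      rw [← hxy] at hy'
      exact hd (this x) hy'

/-- For the path `G = P₄`, one has `depth_S I(G)² = 2` (with the convention
`depth_S I(G)² = depth_S(S/I(G)²) + 1`) and `α₂(G) = 2`; in particular
`depth_S I(G)² = α₂(G)`, so the bound for triangle-free graphs is sharp. -/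
theorem depth_sharp_path_four (K : Type) [Field K] :
    quotDepth K (edgeIdeal K pathFour ^ 2) + 1 = 2 ∧
    starPackingNumber pathFour = 2 ∧
    quotDepth K (edgeIdeal K pathFour ^ 2) + 1 = starPackingNumber pathFour := by
  rw [quotDepth_eq, starPacking_eq]
  exact ⟨rfl, rfl, rfl⟩
end
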